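/- Let 0 < p ≤ 2 and let f = (f^{(A)})_{A∈ℕ} be the martingale constructed from the sequence (α_k). Then its Vilenkin–Fourier coefficients are f̂(j) = (1/M) · M_{α_k}^{1/p−1} · Φ_{M_{α_k}}^{−1/4} whenever j ∈ {M_{α_k}, M_{α_k}+1, …, M_{α_k+1} − 1} for some k ≥ 1, and f̂(j) = 0 for all other j. -/

import Mathlib

open MeasureTheory Filter Finset
open scoped Classical ENNReal NNReal

noncomputable section

namespace VilenkinPaper

/-- The generalized powers `M_0 = 1`, `M_{k+1} = m_k M_k`. -/
def Mseq (m : ℕ → ℕ) : ℕ → ℕ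
  | 0 => 1
  | k + 1 => m k * Mseq m k

/-- The Vilenkin group `G_m = ∏_k ℤ_{m_k}`. -/
abbrev Gm (m : ℕ → ℕ) : Type := (k : ℕ) → ZMod (m k)

/-- The `j`-th digit of `n` in the generalized number system based on `m`. -/
def digit (m : ℕ → ℕ) (n j : ℕ) : ℕ := n / Mseq m j % m j

/-- The generalized Rademacher functions `r_k(x) = exp(2πi x_k / m_k)`. -/
def rad (m : ℕ → ℕ) (k : ℕ) (x : Gm m) : ℂ :=
  Complex.exp (2 * Real.pi * Complex.I * ((x k).val : ℂ) / (m k : ℂ))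

/-- The Vilenkin system `ψ_n = ∏_k r_k^{n_k}`. -/
def psi (m : ℕ → ℕ) (n : ℕ) (x : Gm m) : ℂ := ∏ᶠ k : ℕ, rad m k x ^ digit m n k

/-- The Dirichlet kernels `D_n = ∑_{k<n} ψ_k`. -/
def Dker (m : ℕ → ℕ) (n : ℕ) (x : Gm m) : ℂ := ∑ k ∈ Finset.range n, psi m k x

/-- The interval `I_n(x)` : all `y` agreeing with `x` on the first `n` coordinates. -/
def Iset (m : ℕ → ℕ) (n : ℕ) (x : Gm m) : Set (Gm m) := {y | ∀ k < n, y k = x k}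

/-- `I_n := I_n(0)`. -/
def IsetO (m : ℕ → ℕ) (n : ℕ) : Set (Gm m) := Iset m n 0

/-- `μ` is the normalized Haar (product) measure iff every interval `I_n(x)` has
measure `1 / M_n`. -/
def IsHaarGm (m : ℕ → ℕ) (μ : Measure (Gm m)) : Prop :=
  ∀ n x, μ (Iset m n x) = ((Mseq m n : ℝ≥0∞))⁻¹

/-- The σ-algebra `F_n` generated by the intervals `{I_n(x)}`, i.e. by the first `n`
coordinates. -/
def filt (m : ℕ → ℕ) (n : ℕ) : MeasurableSpace (Gm m) :=
  MeasurableSpace.comap (fun x (k : Fin n) => x k) ⊤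

/-- A (Vilenkin) martingale with respect to the filtration `F_n`. -/
def IsVMartingale (m : ℕ → ℕ) (μ : Measure (Gm m)) (f : ℕ → Gm m → ℂ) : Prop :=
  (∀ n, Integrable (f n) μ) ∧
  (∀ n, Measurable[filt m n] (f n)) ∧
  (∀ n N, n ≤ N → μ[f N | filt m n] =ᵐ[μ] f n)

/-- Membership in the martingale Hardy space `H_p`: the maximal function
`f* = sup_n |f^{(n)}|` belongs to `L_p`. -/
def MemHp (m : ℕ → ℕ) (μ : Measure (Gm m)) (p : ℝ) (f : ℕ → Gm m → ℂ) : Prop :=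
  ∫⁻ x, (⨆ n, (‖f n x‖₊ : ℝ≥0∞)) ^ p ∂μ < ⊤

/-- The `i`-th Vilenkin–Fourier coefficient of an integrable function. -/
def fourierCoefFn (m : ℕ → ℕ) (μ : Measure (Gm m)) (g : Gm m → ℂ) (i : ℕ) : ℂ :=
  ∫ x, g x * (starRingEnd ℂ) (psi m i x) ∂μ

/-- The partial sum `S_n` built from a sequence `c` of Fourier coefficients. -/
def Spart (m : ℕ → ℕ) (c : ℕ → ℂ) (n : ℕ) (x : Gm m) : ℂ :=
  ∑ k ∈ Finset.range n, c k * psi m k x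

/-- The weak `L_{p,∞}` quasinorm `sup_{λ>0} λ μ(|g| > λ)^{1/p}`. -/
def wLp (m : ℕ → ℕ) (μ : Measure (Gm m)) (p : ℝ) (g : Gm m → ℂ) : ℝ≥0∞ :=
  ⨆ (t : ℝ) (_ : 0 < t), ENNReal.ofReal t * μ {x | t < ‖g x‖} ^ (1 / p)

/-- `|n| = max {j : n_j ≠ 0}`. -/
def maxDigit (m : ℕ → ℕ) (n : ℕ) : ℕ := sSup {j | digit m n j ≠ 0}

/-- The set `ℕ_{n_0}` of positive integers with `n_0 = n_{|n|} = 1`. -/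
def Nn0 (m : ℕ → ℕ) : Set ℕ :=
  {n | 0 < n ∧ digit m n 0 = 1 ∧ digit m n (maxDigit m n) = 1}

/-- The atom `a = (M_α^{1/p-1}/M) (D_{M_{α+1}} - D_{M_α})`. -/
def atomFun (m : ℕ → ℕ) (MM : ℕ) (p : ℝ) (a : ℕ) (x : Gm m) : ℂ :=
  (((Mseq m a : ℝ) ^ (1 / p - 1) / (MM : ℝ) : ℝ) : ℂ) *
    (Dker m (Mseq m (a + 1)) x - Dker m (Mseq m a) x)

/-- The coefficients `λ_k = Φ_{M_{α_k}}^{-1/4}`. -/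
def lamSeq (m : ℕ → ℕ) (Φ : ℕ → ℝ) (α : ℕ → ℕ) (k : ℕ) : ℝ :=
  Φ (Mseq m (α k)) ^ (-(1 / 4 : ℝ))

/-- The martingale `f^{(A)} = ∑_{k : α_k < A} λ_k a_k` of the counterexample construction. -/
def fCon (m : ℕ → ℕ) (MM : ℕ) (p : ℝ) (Φ : ℕ → ℝ) (α : ℕ → ℕ) (A : ℕ) (x : Gm m) : ℂ :=
  ∑ᶠ (k : ℕ) (_ : α k < A), (lamSeq m Φ α k : ℂ) * atomFun m MM p (α k) x

section Digits

variable {m : ℕ → ℕ}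

lemma Mseq_pos (hm : ∀ k, 2 ≤ m k) (k : ℕ) : 0 < Mseq m k := by
  induction k with
  | zero => exact Nat.one_pos
  | succ k ih => exact Nat.mul_pos (by have := hm k; omega) ih

lemma Mseq_mono (hm : ∀ k, 2 ≤ m k) : Monotone (Mseq m) :=
  monotone_nat_of_le_succ fun k =>
    Nat.le_mul_of_pos_left _ (by have := hm k; omega)

lemma lt_Mseq (hm : ∀ k, 2 ≤ m k) (n : ℕ) : n < Mseq m n := by
  induction n with
  | zero => exact Nat.one_pos
  | succ n ih =>
    have h : 2 * Mseq m n ≤ m n * Mseq m n := Nat.mul_le_mul_right _ (hm n)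
    simp only [Mseq]
    omega

lemma Mseq_eq_prod (m : ℕ → ℕ) (N : ℕ) : Mseq m N = ∏ k : Fin N, m k := by
  rw [← Finset.prod_range]
  induction N with
  | zero => simp [Mseq]
  | succ N ih => rw [Finset.prod_range_succ, Mseq, ih, mul_comm]

lemma digit_eq_zero (hm : ∀ k, 2 ≤ m k) {n N k : ℕ} (hn : n < Mseq m N) (hk : N ≤ k) :
    digit m n k = 0 := by
  simp [digit, Nat.div_eq_of_lt (hn.trans_le (Mseq_mono hm hk))]

lemma digit_lt (hm : ∀ k, 2 ≤ m k) (n k : ℕ) : digit m n k < m k :=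
  Nat.mod_lt _ (by have := hm k; omega)

lemma mod_Mseq_eq_of_digit_eq {a b N : ℕ} (h : ∀ k < N, digit m a k = digit m b k) :
    a % Mseq m N = b % Mseq m N := by
  induction N with
  | zero => simp [Mseq, Nat.mod_one]
  | succ N ih =>
    have hN : a / Mseq m N % m N = b / Mseq m N % m N := h N N.lt_succ_self
    rw [Mseq, mul_comm, Nat.mod_mul, Nat.mod_mul, ih fun k hk => h k (hk.trans N.lt_succ_self), hN]

end Digits

section Orthonormality

variable {m : ℕ → ℕ}

/-- The first `N` coordinates of a point of `G_m`. -/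
def initialCoords (m : ℕ → ℕ) (N : ℕ) (x : Gm m) (k : Fin N) : ZMod (m k) := x k

lemma measurable_initialCoords (m : ℕ → ℕ) (N : ℕ) : Measurable (initialCoords m N) :=
  measurable_pi_lambda _ fun k => measurable_pi_apply (k : ℕ)

lemma IsHaarGm.map_initialCoords_singleton {μ : Measure (Gm m)} (hμ : IsHaarGm m μ) {N : ℕ}
    (y : (k : Fin N) → ZMod (m k)) :
    μ.map (initialCoords m N) {y} = (Mseq m N : ℝ≥0∞)⁻¹ := by
  rw [Measure.map_apply (measurable_initialCoords m N) (measurableSet_singleton y),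
    ← hμ N fun k => if h : k < N then y ⟨k, h⟩ else 0]
  congr 1
  ext x
  simp only [Set.mem_preimage, Set.mem_singleton_iff, funext_iff, initialCoords, Iset,
    Set.mem_ofPred_eq, Fin.forall_iff]
  refine forall₂_congr fun k hk => ?_
  simp [hk]

lemma IsHaarGm.isProbabilityMeasure {μ : Measure (Gm m)} (hμ : IsHaarGm m μ) :
    IsProbabilityMeasure μ :=
  ⟨by simpa [Iset, Mseq] using hμ 0 0⟩

lemma IsHaarGm.integral_prod_initialCoords [∀ k, NeZero (m k)] {μ : Measure (Gm m)}
    (hμ : IsHaarGm m μ) (N : ℕ) (f : (k : Fin N) → ZMod (m k) → ℂ) :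
    ∫ x, ∏ k : Fin N, f k (x k) ∂μ = (Mseq m N : ℂ)⁻¹ * ∏ k, ∑ z, f k z := by
  have := hμ.isProbabilityMeasure
  have := Measure.isProbabilityMeasure_map (μ := μ) (measurable_initialCoords m N).aemeasurable
  change ∫ x, ∏ k, f k (initialCoords m N x k) ∂μ = _
  rw [← integral_map (φ := initialCoords m N) (f := fun y => ∏ k, f k (y k))
      (measurable_initialCoords m N).aemeasurable Integrable.of_finite.aestronglyMeasurable,
    integral_fintype Integrable.of_finite, Fintype.prod_sum, Finset.mul_sum]
  refine Finset.sum_congr rfl fun y _ => ?_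
  simp [measureReal_def, hμ.map_initialCoords_singleton]

lemma psi_eq_prod (hm : ∀ k, 2 ≤ m k) {n N : ℕ} (hn : n < Mseq m N) (x : Gm m) :
    psi m n x = ∏ k : Fin N, rad m k x ^ digit m n k := by
  rw [← Finset.prod_range fun k => rad m k x ^ digit m n k, psi]
  refine finprod_eq_prod_of_mulSupport_subset _ fun k hk => ?_
  by_contra hkN
  simp only [Finset.coe_range, Set.mem_Iio, not_lt] at hkN
  simp [digit_eq_zero hm hn hkN] at hk

lemma rad_eq_stdAddChar (k : ℕ) [NeZero (m k)] (x : Gm m) :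
    rad m k x = ZMod.stdAddChar (x k) := by
  rw [ZMod.stdAddChar_apply, ZMod.toCircle_apply, rad]

lemma sum_stdAddChar_pow_mul_conj_pow {n : ℕ} [NeZero n] {a b : ℕ} (ha : a < n) (hb : b < n) :
    ∑ z : ZMod n, (ZMod.stdAddChar z : ℂ) ^ a * (starRingEnd ℂ) (ZMod.stdAddChar z ^ b) =
      if a = b then (n : ℂ) else 0 := by
  have h := AddChar.sum_mulShift (ψ := (ZMod.stdAddChar : AddChar (ZMod n) ℂ)) ((a : ZMod n) - b)
    (ZMod.isPrimitive_stdAddChar n)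
  have hab : (a : ZMod n) - b = 0 ↔ a = b := by
    rw [sub_eq_zero, ZMod.natCast_eq_natCast_iff', Nat.mod_eq_of_lt ha, Nat.mod_eq_of_lt hb]
  simp only [hab, ZMod.card, Nat.cast_ite, Nat.cast_zero] at h
  rw [← h]
  refine Finset.sum_congr rfl fun z _ => ?_
  rw [← AddChar.map_nsmul_eq_pow, ← AddChar.map_nsmul_eq_pow, ← AddChar.map_neg_eq_conj,
    ← AddChar.map_add_eq_mul]
  congr 1
  simp only [nsmul_eq_mul]
  ring

lemma integrable_psi_mul_conj_psi (hm : ∀ k, 2 ≤ m k) {μ : Measure (Gm m)}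
    (hμ : IsHaarGm m μ) (a b : ℕ) :
    Integrable (fun x => psi m a x * (starRingEnd ℂ) (psi m b x)) μ := by
  have : ∀ k, NeZero (m k) := fun k => ⟨by have := hm k; omega⟩
  have := hμ.isProbabilityMeasure
  obtain ⟨N, haN, hbN⟩ : ∃ N, a < Mseq m N ∧ b < Mseq m N :=
    ⟨max a b, (le_max_left a b).trans_lt (lt_Mseq hm _), (le_max_right a b).trans_lt (lt_Mseq hm _)⟩
  have := Measure.isProbabilityMeasure_map (μ := μ) (measurable_initialCoords m N).aemeasurable
  have h : Integrable (fun y : (k : Fin N) → ZMod (m k) =>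
      (∏ k, (ZMod.stdAddChar (y k) : ℂ) ^ digit m a k) *
        (starRingEnd ℂ) (∏ k, ZMod.stdAddChar (y k) ^ digit m b k))
      (μ.map (initialCoords m N)) := Integrable.of_finite
  simpa only [Function.comp_def, initialCoords, psi_eq_prod hm haN, psi_eq_prod hm hbN,
    rad_eq_stdAddChar] using h.comp_measurable (measurable_initialCoords m N)

/-- The Vilenkin system is orthonormal. -/
lemma integral_psi_mul_conj_psi (hm : ∀ k, 2 ≤ m k) {μ : Measure (Gm m)}
    (hμ : IsHaarGm m μ) (a b : ℕ) :
    ∫ x, psi m a x * (starRingEnd ℂ) (psi m b x) ∂μ = if a = b then 1 else 0 := by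
  have : ∀ k, NeZero (m k) := fun k => ⟨by have := hm k; omega⟩
  obtain ⟨N, haN, hbN⟩ : ∃ N, a < Mseq m N ∧ b < Mseq m N :=
    ⟨max a b, (le_max_left a b).trans_lt (lt_Mseq hm _), (le_max_right a b).trans_lt (lt_Mseq hm _)⟩
  simp only [psi_eq_prod hm haN, psi_eq_prod hm hbN, rad_eq_stdAddChar, map_prod,
    ← Finset.prod_mul_distrib]
  rw [hμ.integral_prod_initialCoords N fun k z => (ZMod.stdAddChar z : ℂ) ^ digit m a k *
    (starRingEnd ℂ) (ZMod.stdAddChar z ^ digit m b k)]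
  simp only [sum_stdAddChar_pow_mul_conj_pow (digit_lt hm a _) (digit_lt hm b _)]
  split_ifs with hab
  · subst hab
    have hM : (Mseq m N : ℂ) ≠ 0 := Nat.cast_ne_zero.2 (Mseq_pos hm N).ne'
    simp only [if_true]
    rw [← Nat.cast_prod, ← Mseq_eq_prod, inv_mul_cancel₀ hM]
  · obtain ⟨k, hk, hne⟩ : ∃ k < N, digit m a k ≠ digit m b k := by
      by_contra! h
      have := mod_Mseq_eq_of_digit_eq h
      rw [Nat.mod_eq_of_lt haN, Nat.mod_eq_of_lt hbN] at this
      exact hab this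
    rw [Finset.prod_eq_zero (Finset.mem_univ ⟨k, hk⟩) (if_neg hne), mul_zero]

end Orthonormality

section Coefficients

variable {m : ℕ → ℕ}

/-- The constant factor of the atom `atomFun m MM p a`. -/
def atomScale (m : ℕ → ℕ) (MM : ℕ) (p : ℝ) (a : ℕ) : ℝ :=
  (Mseq m a : ℝ) ^ (1 / p - 1) / (MM : ℝ)

lemma atomFun_eq_sum (hm : ∀ k, 2 ≤ m k) (MM : ℕ) (p : ℝ) (a : ℕ) (x : Gm m) :
    atomFun m MM p a x =
      (atomScale m MM p a : ℂ) * ∑ l ∈ Finset.Ico (Mseq m a) (Mseq m (a + 1)), psi m l x := by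
  rw [Finset.sum_Ico_eq_sub _ (Mseq_mono hm a.le_succ)]
  rfl

lemma fCon_eq_sum {α : ℕ → ℕ} (hα : StrictMono α) (MM : ℕ) (p : ℝ) (Φ : ℕ → ℝ) (A : ℕ)
    (x : Gm m) :
    fCon m MM p Φ α A x =
      ∑ k ∈ (Finset.range A).filter (α · < A), (lamSeq m Φ α k : ℂ) * atomFun m MM p (α k) x := by
  refine finsum_mem_eq_sum_of_subset (s := {k | α k < A}) _ (fun k hk => ?_) (fun k hk => ?_)
  · have hkA : α k < A := hk.1
    simpa using And.intro ((hα.id_le k).trans_lt hkA) hkA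
  · exact (Finset.mem_filter.1 hk).2

lemma fourierCoefFn_fCon (hm : ∀ k, 2 ≤ m k) {μ : Measure (Gm m)} (hμ : IsHaarGm m μ)
    {α : ℕ → ℕ} (hα : StrictMono α) (MM : ℕ) (p : ℝ) (Φ : ℕ → ℝ) (A j : ℕ) :
    fourierCoefFn m μ (fCon m MM p Φ α A) j =
      ∑ k ∈ (Finset.range A).filter (α · < A),
        if j ∈ Finset.Ico (Mseq m (α k)) (Mseq m (α k + 1)) then
          (lamSeq m Φ α k : ℂ) * (atomScale m MM p (α k) : ℂ) else 0 := by
  have hint : ∀ k, Integrable (fun x => ∑ l ∈ Finset.Ico (Mseq m (α k)) (Mseq m (α k + 1)),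
      psi m l x * (starRingEnd ℂ) (psi m j x)) μ := fun k =>
    integrable_finsetSum _ fun l _ => integrable_psi_mul_conj_psi hm hμ l j
  simp only [fourierCoefFn, fCon_eq_sum hα, atomFun_eq_sum hm, ← mul_assoc, Finset.sum_mul]
  simp only [mul_assoc _ (∑ l ∈ _, _) _, Finset.sum_mul]
  rw [integral_finsetSum _ fun k _ => (hint k).const_mul _]
  refine Finset.sum_congr rfl fun k _ => ?_
  rw [integral_const_mul,
    integral_finsetSum _ fun l _ => integrable_psi_mul_conj_psi hm hμ l j]
  simp only [integral_psi_mul_conj_psi hm hμ, Finset.sum_ite_eq']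
  split_ifs <;> simp

lemma eq_of_mem_Ico_Mseq (hm : ∀ k, 2 ≤ m k) {a b j : ℕ}
    (ha : j ∈ Finset.Ico (Mseq m a) (Mseq m (a + 1)))
    (hb : j ∈ Finset.Ico (Mseq m b) (Mseq m (b + 1))) : a = b := by
  rw [Finset.mem_Ico] at ha hb
  have h₁ : a < b + 1 := (Mseq_mono hm).reflect_lt (ha.1.trans_lt hb.2)
  have h₂ : b < a + 1 := (Mseq_mono hm).reflect_lt (hb.1.trans_lt ha.2)
  omega

end Coefficients

theorem statement11 (m : ℕ → ℕ) (hm : ∀ k, 2 ≤ m k)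
    (MM : ℕ) (hMM : IsLUB (Set.range m) MM)
    (μ : Measure (Gm m)) (hμ : IsHaarGm m μ)
    (p : ℝ) (hp0 : 0 < p) (hp2 : p ≤ 2)
    (Φ : ℕ → ℝ) (hΦpos : ∀ n, 0 < Φ n) (hΦmono : Monotone Φ)
    (hΦtop : Tendsto Φ atTop atTop)
    (α : ℕ → ℕ) (hα : StrictMono α) (hα2 : ∀ k, 2 ≤ α k)
    (hsum : Summable fun k => Φ (Mseq m (α k)) ^ (-(p / 4) : ℝ))
    (c : ℕ → ℂ)
    (hc : ∀ i, Tendsto (fun k => fourierCoefFn m μ (fCon m MM p Φ α k) i) atTop (nhds (c i))) :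
    (∀ k j, Mseq m (α k) ≤ j → j < Mseq m (α k + 1) →
      c j = ((1 / (MM : ℝ) * (Mseq m (α k) : ℝ) ^ (1 / p - 1) *
        Φ (Mseq m (α k)) ^ (-(1 / 4) : ℝ) : ℝ) : ℂ)) ∧
    (∀ j, (∀ k, ¬(Mseq m (α k) ≤ j ∧ j < Mseq m (α k + 1))) → c j = 0) := by
  have hlim : ∀ j (v : ℂ), (∀ᶠ A in atTop, fourierCoefFn m μ (fCon m MM p Φ α A) j = v) →
      c j = v := fun j v h =>
    tendsto_nhds_unique (hc j) (tendsto_const_nhds.congr' (h.mono fun _ hA => hA.symm))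
  refine ⟨fun k j hkj hjk => hlim j _ ?_, fun j hj => hlim j _ (Eventually.of_forall fun A => ?_)⟩
  · filter_upwards [eventually_gt_atTop (α k)] with A hA
    have hjk' := Finset.mem_Ico.2 ⟨hkj, hjk⟩
    rw [fourierCoefFn_fCon hm hμ hα, Finset.sum_eq_single k]
    · rw [if_pos hjk', lamSeq, atomScale, ← Complex.ofReal_mul]
      congr 1
      ring
    · exact fun l _ hlk => if_neg fun hl => hlk (hα.injective (eq_of_mem_Ico_Mseq hm hl hjk'))
    · exact fun hk => (hk (Finset.mem_filter.2
        ⟨Finset.mem_range.2 ((hα.id_le k).trans_lt hA), hA⟩)).elim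
  · rw [fourierCoefFn_fCon hm hμ hα]
    exact Finset.sum_eq_zero fun k _ => if_neg fun hk => hj k (Finset.mem_Ico.1 hk)

end VilenkinPaper
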